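/- arXiv:math/9503234 — 2 statements merged into one kernel-verified Lean document; each statement's English description precedes it below -/
import Mathlib

section
/- Correctness of Dodgson's condensation method (equation (3.10)): Let K be a field and A : ℤ → ℤ → K. For k ≥ 1 and x, y ∈ ℤ let M_k(x,y) denote the determinant of the k×k matrix whose (i,j) entry is A(x+i−1, y+j−1), and set M_0(x,y) = 1. Suppose f : ℕ → ℤ → ℤ → K satisfies f_0(x,y) = 1 and f_1(x,y) = A(x,y) for all x, y, and for every k ≥ 1 and all x, y: f_{k−1}(x+1, y+1) ≠ 0 and f_{k+1}(x,y)·f_{k−1}(x+1, y+1) = f_k(x,y)·f_k(x+1, y+1) − f_k(x, y+1)·f_k(x+1, y). Then f_k(x,y) = M_k(x,y) for all k ≥ 0 and all x, y ∈ ℤ. -/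
/-- The determinant of the submatrix of `M` on the rows `g, p` and the columns `g, q`, expressed by
the Schur complement of the block on `g, g`. -/
theorem Matrix.det_submatrix_sumElim_of_det_ne_zero {K ι κ m : Type*} [Field K]
    [Fintype ι] [DecidableEq ι] [Fintype κ] [DecidableEq κ] (M : Matrix m m K)
    (g : ι → m) (p q : κ → m) (h : (M.submatrix g g).det ≠ 0) :
    (M.submatrix (Sum.elim g p) (Sum.elim g q)).det =
      (M.submatrix g g).det *
        (M.submatrix p q - M.submatrix p g * (M.submatrix g g)⁻¹ * M.submatrix g q).det := by
  have hM : M.submatrix (Sum.elim g p) (Sum.elim g q) =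
      Matrix.fromBlocks (M.submatrix g g) (M.submatrix g q)
        (M.submatrix p g) (M.submatrix p q) := by
    ext i j
    rcases i with i | i <;> rcases j with j | j <;> rfl
  let _ : Invertible (M.submatrix g g) := Matrix.invertibleOfIsUnitDet _ h.isUnit
  rw [hM, Matrix.det_fromBlocks₁₁, Matrix.invOf_eq_nonsing_inv]

/-- The **Desnanot–Jacobi identity**, for a matrix whose central minor does not vanish. -/
theorem Matrix.det_mul_det_submatrix_center {K : Type*} [Field K] {n : ℕ}
    (M : Matrix (Fin (n + 2)) (Fin (n + 2)) K)
    (h : (M.submatrix (fun i : Fin n => i.castSucc.succ) (fun i => i.castSucc.succ)).det ≠ 0) :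
    M.det * (M.submatrix (fun i : Fin n => i.castSucc.succ) (fun i => i.castSucc.succ)).det =
      (M.submatrix Fin.castSucc Fin.castSucc).det * (M.submatrix Fin.succ Fin.succ).det -
        (M.submatrix Fin.castSucc Fin.succ).det * (M.submatrix Fin.succ Fin.castSucc).det := by
  set g : Fin n → Fin (n + 2) := fun i => i.castSucc.succ with hg
  let first : Fin n ⊕ Unit ≃ Fin (n + 1) :=
    (Equiv.optionEquivSumPUnit (Fin n)).symm.trans (finSuccEquiv n).symm
  let last : Fin n ⊕ Unit ≃ Fin (n + 1) :=
    (Equiv.optionEquivSumPUnit (Fin n)).symm.trans finSuccEquivLast.symm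
  let ends : Fin 2 → Fin (n + 2) := ![0, Fin.last (n + 1)]
  have hbij : Function.Bijective (Sum.elim g ends) := by
    rw [Fintype.bijective_iff_injective_and_card]
    refine ⟨Function.Injective.sumElim ?_ ?_ ?_, by simp⟩
    · intro i j hij
      simpa [hg] using hij
    · intro i j hij
      fin_cases i <;> fin_cases j <;> simp_all [ends, Fin.ext_iff]
    · intro i j
      have := i.isLt
      fin_cases j <;> simp [hg, ends, Fin.ext_iff]
      omega
  have hfirst : Fin.castSucc ∘ first = Sum.elim g fun _ => 0 := by
    ext i
    rcases i with i | i <;> simp [first, hg]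
  have hlast : Fin.succ ∘ last = Sum.elim g fun _ => Fin.last (n + 1) := by
    ext i
    rcases i with i | i <;> simp [last, hg]
  set τ : Equiv.Perm (Fin n ⊕ Unit) := first.trans last.symm with hτ
  have hlτ : last ∘ τ = first := by
    ext i
    simp [hτ]
  set S : Fin (n + 2) → Fin (n + 2) → K := fun a b =>
    M a b - (M.submatrix id g * (M.submatrix g g)⁻¹ * M.submatrix g id) a b with hS
  have hborder (a b : Fin (n + 2)) :
      (M.submatrix (Sum.elim g fun _ : Unit => a) (Sum.elim g fun _ : Unit => b)).det =
        (M.submatrix g g).det * S a b := by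
    rw [Matrix.det_submatrix_sumElim_of_det_ne_zero M g _ _ h, Matrix.det_unique (n := Unit)]
    rfl
  have hdet : M.det = (M.submatrix g g).det *
      (S 0 0 * S (Fin.last (n + 1)) (Fin.last (n + 1)) -
        S 0 (Fin.last (n + 1)) * S (Fin.last (n + 1)) 0) := by
    rw [← Matrix.det_submatrix_equiv_self (Equiv.ofBijective _ hbij) M]
    simp only [Equiv.coe_ofBijective]
    rw [Matrix.det_submatrix_sumElim_of_det_ne_zero M g _ _ h, Matrix.det_fin_two]
    rfl
  have h00 : (M.submatrix Fin.castSucc Fin.castSucc).det = (M.submatrix g g).det * S 0 0 := by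
    rw [← Matrix.det_submatrix_equiv_self first, Matrix.submatrix_submatrix, hfirst, hborder]
  have hll : (M.submatrix Fin.succ Fin.succ).det =
      (M.submatrix g g).det * S (Fin.last (n + 1)) (Fin.last (n + 1)) := by
    rw [← Matrix.det_submatrix_equiv_self last, Matrix.submatrix_submatrix, hlast, hborder]
  have h0l : (M.submatrix Fin.castSucc Fin.succ).det = ((Equiv.Perm.sign τ : ℤ) : K) *
      ((M.submatrix g g).det * S 0 (Fin.last (n + 1))) := by
    rw [← Matrix.det_submatrix_equiv_self first, Matrix.submatrix_submatrix, hfirst, ← hlτ,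
      ← Function.comp_assoc, hlast, ← hborder, ← Matrix.det_permute']
    rfl
  have hl0 : (M.submatrix Fin.succ Fin.castSucc).det = ((Equiv.Perm.sign τ : ℤ) : K) *
      ((M.submatrix g g).det * S (Fin.last (n + 1)) 0) := by
    rw [← Matrix.det_submatrix_equiv_self first, Matrix.submatrix_submatrix, hfirst, ← hlτ,
      ← Function.comp_assoc, hlast, ← hborder, ← Matrix.det_permute]
    rfl
  have hsign : ((Equiv.Perm.sign τ : ℤ) : K) * ((Equiv.Perm.sign τ : ℤ) : K) = 1 := by
    rw [← Int.cast_mul, ← Units.val_mul, Int.units_mul_self, Units.val_one, Int.cast_one]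
  rw [hdet, h00, hll, h0l, hl0]
  linear_combination ((M.submatrix g g).det * S 0 (Fin.last (n + 1)) *
    ((M.submatrix g g).det * S (Fin.last (n + 1)) 0)) * hsign


/-- **Correctness of Dodgson's condensation method** (equation (3.10)).  Let `A : ℤ → ℤ → K`
and let `M k x y` be the determinant of the `k×k` matrix with `(i,j)` entry `A (x+i−1) (y+j−1)`
(so `M 0 x y = 1`).  If `f : ℕ → ℤ → ℤ → K` satisfies `f 0 x y = 1`, `f 1 x y = A x y`, and for
every `k ≥ 1` the condensation recurrence with nonvanishing divisors, then `f k x y = M k x y`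
for all `k`, `x`, `y`. -/
theorem dodgson_condensation {K : Type*} [Field K] (A : ℤ → ℤ → K) (f : ℕ → ℤ → ℤ → K)
    (h0 : ∀ x y : ℤ, f 0 x y = 1)
    (h1 : ∀ x y : ℤ, f 1 x y = A x y)
    (hne : ∀ k : ℕ, 1 ≤ k → ∀ x y : ℤ, f (k - 1) (x + 1) (y + 1) ≠ 0)
    (hrec : ∀ k : ℕ, 1 ≤ k → ∀ x y : ℤ,
      f (k + 1) x y * f (k - 1) (x + 1) (y + 1) =
        f k x y * f k (x + 1) (y + 1) - f k x (y + 1) * f k (x + 1) y) :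
    ∀ (k : ℕ) (x y : ℤ), f k x y =
      Matrix.det (Matrix.of fun i j : Fin k => A (x + (i : ℕ)) (y + (j : ℕ))) := by
  have key : ∀ k : ℕ,
      (∀ x y : ℤ, f k x y =
        Matrix.det (Matrix.of fun i j : Fin k => A (x + (i : ℕ)) (y + (j : ℕ)))) ∧
      (∀ x y : ℤ, f (k + 1) x y =
        Matrix.det (Matrix.of fun i j : Fin (k + 1) => A (x + (i : ℕ)) (y + (j : ℕ)))) := by
    intro k
    induction k with
    | zero => exact ⟨fun x y => by simp [h0], fun x y => by simp [h1]⟩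
    | succ n ih =>
      refine ⟨ih.2, fun x y => ?_⟩
      have hn := hne (n + 1) (by omega) x y
      have hr := hrec (n + 1) (by omega) x y
      rw [Nat.add_sub_cancel] at hn hr
      refine mul_right_cancel₀ hn (hr.trans ?_)
      rw [ih.1] at hn ⊢
      simp only [ih.2]
      have hshift (z : ℤ) (i : ℕ) : z + 1 + (i : ℤ) = z + ((i + 1 : ℕ) : ℤ) := by
        push_cast
        ring
      simp only [hshift] at hn ⊢
      exact (Matrix.det_mul_det_submatrix_center
        (Matrix.of fun i j : Fin (n + 2) => A (x + (i : ℕ)) (y + (j : ℕ))) hn).symm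
  exact fun k => (key k).1
end

section
/- Equation (3.16) (Jacobi's theorem on minors of the adjugate): Let α be a repetition-free word of row indices and β a repetition-free word of column indices with |α| = |β|; let x₁,…,x_n (n ≥ 1) be distinct row indices not occurring in α and y₁,…,y_n distinct column indices not occurring in β; write χ = x₁⋯x_n and ψ = y₁⋯y_n. Then A[α,β]·A[αχ, βψ]^{n−1} equals the determinant of the n×n matrix B whose (i,j) entry is B_{ij} = A[α(χ∖x_i), β(ψ∖y_j)], where χ∖x_i is χ with the letter x_i deleted (order preserved) and ψ∖y_j is ψ with y_j deleted. -/
/-- `listDet A α β` is the determinant `A[α,β]` of the square matrix whose `(i,j)` entry is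
`A αᵢ βⱼ`, for words `α`, `β` of equal length (and junk value `0` otherwise). -/
def listDet {I J R : Type*} [CommRing R] (A : I → J → R) (α : List I) (β : List J) : R :=
  if h : α.length = β.length then
    Matrix.det (Matrix.of fun i j : Fin α.length => A (α.get i) (β.get (Fin.cast h j)))
  else 0


/-- A block form of Jacobi's theorem, before cancelling a factor `M.det`. -/
theorem Matrix.det_mul_det_toBlocks₂₂_adjugate {R m k : Type*} [CommRing R]
    [Fintype m] [DecidableEq m] [Fintype k] [DecidableEq k] (M : Matrix (m ⊕ k) (m ⊕ k) R) :
    M.det * M.adjugate.toBlocks₂₂.det = M.toBlocks₁₁.det * M.det ^ Fintype.card k := by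
  have h : M * Matrix.fromBlocks 1 M.adjugate.toBlocks₁₂ 0 M.adjugate.toBlocks₂₂ =
      Matrix.fromBlocks M.toBlocks₁₁ 0 M.toBlocks₂₁ (M.det • 1) := by
    have hadj := M.mul_adjugate
    generalize M.adjugate = N at hadj ⊢
    generalize M.det = d at hadj ⊢
    rw [← M.fromBlocks_toBlocks, ← N.fromBlocks_toBlocks, Matrix.fromBlocks_multiply,
      ← Matrix.fromBlocks_one, Matrix.fromBlocks_smul, Matrix.fromBlocks_inj] at hadj
    conv_lhs => rw [← M.fromBlocks_toBlocks]
    rw [Matrix.fromBlocks_multiply, hadj.2.1, hadj.2.2.2]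
    simp
  have hdet := congrArg Matrix.det h
  rw [Matrix.det_mul, Matrix.det_fromBlocks_zero₂₁, Matrix.det_fromBlocks_zero₁₂] at hdet
  simpa using hdet

/-- **Jacobi's theorem** on complementary minors of the adjugate, in block form. -/
theorem Matrix.det_toBlocks₂₂_adjugate {R m k : Type*} [CommRing R]
    [Fintype m] [DecidableEq m] [Fintype k] [DecidableEq k] [Nonempty k]
    (M : Matrix (m ⊕ k) (m ⊕ k) R) :
    M.adjugate.toBlocks₂₂.det = M.toBlocks₁₁.det * M.det ^ (Fintype.card k - 1) := by
  let X := Matrix.mvPolynomialX (m ⊕ k) (m ⊕ k) ℤ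
  have hX : X.adjugate.toBlocks₂₂.det = X.toBlocks₁₁.det * X.det ^ (Fintype.card k - 1) := by
    apply mul_left_cancel₀ (Matrix.det_mvPolynomialX_ne_zero (m ⊕ k) ℤ)
    rw [Matrix.det_mul_det_toBlocks₂₂_adjugate, mul_left_comm, mul_pow_sub_one Fintype.card_ne_zero]
  let f : MvPolynomial ((m ⊕ k) × (m ⊕ k)) ℤ →+* R :=
    MvPolynomial.eval₂Hom (Int.castRingHom R) fun p => M p.1 p.2
  have hM : f.mapMatrix X = M := Matrix.mvPolynomialX_map_eval₂ (Int.castRingHom R) M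
  have h := congrArg f hX
  have h₁ : f.mapMatrix X.adjugate.toBlocks₂₂ = (f.mapMatrix X.adjugate).toBlocks₂₂ := rfl
  have h₂ : f.mapMatrix X.toBlocks₁₁ = (f.mapMatrix X).toBlocks₁₁ := rfl
  rwa [map_mul, map_pow, RingHom.map_det, RingHom.map_det, RingHom.map_det, h₁, h₂,
    RingHom.map_adjugate, hM] at h

theorem Matrix.adjugate_inr_inr_eq_det_submatrix {R : Type*} [CommRing R] {p n : ℕ}
    (M : Matrix (Fin p ⊕ Fin (n + 1)) (Fin p ⊕ Fin (n + 1)) R) (i j : Fin (n + 1)) :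
    M.adjugate (Sum.inr j) (Sum.inr i) = (-1) ^ (i + j : ℕ) *
      (M.submatrix (Sum.map id i.succAbove) (Sum.map id j.succAbove)).det := by
  let e : Fin p ⊕ Fin (n + 1) ≃ Fin (p + n).succ := finSumFinEquiv
  let e' : Fin p ⊕ Fin n ≃ Fin (p + n) := finSumFinEquiv
  have hl (a : Fin p) : (e (Sum.inl a) : ℕ) = a := rfl
  have hr (i : Fin (n + 1)) : (e (Sum.inr i) : ℕ) = p + i := rfl
  have hl' (a : Fin p) : (e' (Sum.inl a) : ℕ) = a := rfl
  have hr' (a : Fin n) : (e' (Sum.inr a) : ℕ) = p + a := rfl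
  have he (i : Fin (n + 1)) (a : Fin p ⊕ Fin n) :
      e.symm ((e (Sum.inr i)).succAbove (e' a)) = Sum.map id i.succAbove a := by
    rw [Equiv.symm_apply_eq]
    ext
    rcases a with a | a <;>
      simp only [hl, hr, hl', hr', Sum.map_inl, Sum.map_inr, id, Fin.succAbove, Fin.lt_def,
        apply_ite Fin.val, Fin.val_castSucc, Fin.val_succ] <;> split_ifs <;> omega
  have h := Matrix.adjugate_fin_succ_eq_det_submatrix (M.submatrix e.symm e.symm)
    (e (Sum.inr j)) (e (Sum.inr i))
  rw [Matrix.adjugate_submatrix_equiv_self, ← Matrix.det_submatrix_equiv_self e'] at h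
  simp only [Matrix.submatrix_apply, Equiv.symm_apply_apply, Matrix.submatrix_submatrix] at h
  have hcomp (i : Fin (n + 1)) :
      (e.symm ∘ (e (Sum.inr i)).succAbove) ∘ e' = Sum.map id i.succAbove := funext (he i)
  rw [hcomp, hcomp] at h
  rw [h]
  congr 1
  have hs : ((e (Sum.inr i) : ℕ) + (e (Sum.inr j) : ℕ)) = 2 * p + (i + j) := by
    rw [hr, hr]
    omega
  rw [hs, pow_add, pow_mul, neg_one_sq, one_pow, one_mul]

theorem Matrix.det_neg_one_pow_add_mul {R : Type*} [CommRing R] {n : ℕ}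
    (N : Matrix (Fin n) (Fin n) R) :
    (Matrix.of fun i j : Fin n => (-1) ^ (i + j : ℕ) * N i j).det = N.det := by
  have h := Matrix.det_mul_column (fun i : Fin n => (-1 : R) ^ (i : ℕ))
    (Matrix.of fun i j : Fin n => (-1) ^ (j : ℕ) * N i j)
  rw [Matrix.det_mul_row, ← mul_assoc, ← Finset.prod_mul_distrib] at h
  simpa [pow_add, mul_assoc, ← mul_pow] using h

theorem listDet_ofFn {I J R : Type*} [CommRing R] (A : I → J → R) {n : ℕ}
    (u : Fin n → I) (v : Fin n → J) :
    listDet A (List.ofFn u) (List.ofFn v) = (Matrix.of fun i j => A (u i) (v j)).det := by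
  rw [listDet, dif_pos (by simp),
    ← Matrix.det_submatrix_equiv_self (finCongr (List.length_ofFn (f := u)).symm)]
  congr 1
  ext i j
  simp

theorem listDet_ofFn_append_ofFn {I J R : Type*} [CommRing R] (A : I → J → R) {p n : ℕ}
    (u : Fin p → I) (v : Fin p → J) (x : Fin n → I) (y : Fin n → J) :
    listDet A (List.ofFn u ++ List.ofFn x) (List.ofFn v ++ List.ofFn y) =
      (Matrix.of fun a b : Fin p ⊕ Fin n => A (Sum.elim u x a) (Sum.elim v y b)).det := by
  rw [← List.ofFn_fin_append, ← List.ofFn_fin_append, listDet_ofFn,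
    ← Matrix.det_submatrix_equiv_self finSumFinEquiv]
  congr 1
  ext a b
  rcases a with a | a <;> rcases b with b | b <;> simp

theorem List.eraseIdx_ofFn_eq_ofFn_succAbove {I : Type*} {n : ℕ} (x : Fin (n + 1) → I)
    (i : Fin (n + 1)) :
    (List.ofFn x).eraseIdx i = List.ofFn (x ∘ i.succAbove) := by
  apply List.ext_getElem
  · simp [List.length_eraseIdx, Nat.le_of_lt_succ i.isLt]
  · intro k h₁ h₂
    simp only [List.getElem_eraseIdx, List.getElem_ofFn, Function.comp_apply, Fin.succAbove,
      Fin.lt_def, Fin.val_castSucc]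
    split_ifs <;> rfl

/-- **Equation (3.16)** (Jacobi's theorem on minors of the adjugate): if `α`, `β` are
repetition-free row/column words with `|α| = |β|`, and `x₁,…,xₙ` (resp. `y₁,…,yₙ`), `n ≥ 1`,
are distinct row (resp. column) indices not occurring in `α` (resp. `β`), then writing
`χ = x₁⋯xₙ`, `ψ = y₁⋯yₙ`, we have `A[α,β]·A[αχ,βψ]^{n−1} = det B` where
`B i j = A[α(χ∖xᵢ), β(ψ∖yⱼ)]`. -/
theorem jacobi_adjugate_minors {I J R : Type*} [CommRing R] (A : I → J → R)
    (n : ℕ) (hn : 1 ≤ n) (α : List I) (β : List J) (hlen : α.length = β.length)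
    (x : Fin n → I) (y : Fin n → J)
    (hrow : (α ++ List.ofFn x).Nodup) (hcol : (β ++ List.ofFn y).Nodup) :
    listDet A α β * listDet A (α ++ List.ofFn x) (β ++ List.ofFn y) ^ (n - 1) =
      Matrix.det (Matrix.of fun i j : Fin n =>
        listDet A (α ++ (List.ofFn x).eraseIdx i) (β ++ (List.ofFn y).eraseIdx j)) := by
  obtain ⟨n, rfl⟩ : ∃ k, n = k + 1 := ⟨n - 1, by omega⟩
  obtain ⟨p, u, rfl⟩ : ∃ (p : ℕ) (u : Fin p → I), α = List.ofFn u :=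
    ⟨_, α.get, (List.ofFn_get α).symm⟩
  obtain ⟨v, rfl⟩ : ∃ v : Fin p → J, β = List.ofFn v := by
    obtain rfl : p = β.length := by simpa using hlen
    exact ⟨β.get, (List.ofFn_get β).symm⟩
  let M : Matrix (Fin p ⊕ Fin (n + 1)) (Fin p ⊕ Fin (n + 1)) R :=
    Matrix.of fun a b => A (Sum.elim u x a) (Sum.elim v y b)
  have hentry (i j : Fin (n + 1)) :
      listDet A (List.ofFn u ++ (List.ofFn x).eraseIdx i)
        (List.ofFn v ++ (List.ofFn y).eraseIdx j) =
      (-1) ^ (i + j : ℕ) * M.adjugate.toBlocks₂₂.transpose i j := by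
    have hM : (Matrix.of fun a b : Fin p ⊕ Fin n =>
        A (Sum.elim u (x ∘ i.succAbove) a) (Sum.elim v (y ∘ j.succAbove) b)) =
        M.submatrix (Sum.map id i.succAbove) (Sum.map id j.succAbove) := by
      ext a b
      rcases a with a | a <;> rcases b with b | b <;> rfl
    rw [List.eraseIdx_ofFn_eq_ofFn_succAbove, List.eraseIdx_ofFn_eq_ofFn_succAbove,
      listDet_ofFn_append_ofFn, hM, Matrix.transpose_apply, Matrix.toBlocks₂₂, Matrix.of_apply,
      Matrix.adjugate_inr_inr_eq_det_submatrix, ← mul_assoc, ← mul_pow]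
    simp
  simp only [hentry]
  rw [Matrix.det_neg_one_pow_add_mul, Matrix.det_transpose, Matrix.det_toBlocks₂₂_adjugate,
    Fintype.card_fin, listDet_ofFn, listDet_ofFn_append_ofFn]
  rfl
end
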